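/- Let K be an algebraically closed field of characteristic zero, k ≥ 1, and let H ∈ K[y,z] be a linear combination of at most two (2k+2)-nd powers of pairwise linearly independent linear forms in y and z. If the k-th partial derivative ∂^k H/∂y^k lies in z³·K[y,z]_{k-1} (i.e., is a degree-(k+2) binary form divisible by z³), then ∂^k H/∂y^k is a scalar multiple of z^{k+2}. -/

import Mathlib

open MvPolynomial

/-- A binary form of degree one is `a y + b z`. -/
lemma MvPolynomial.IsHomogeneous.exists_eq_binary_linear {R : Type*} [CommSemiring R]
    {p : MvPolynomial (Fin 2) R} (hp : p.IsHomogeneous 1) :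
    ∃ a b : R, p = C a * X 0 + C b * X 1 := by
  rw [← mem_homogeneousSubmodule, homogeneousSubmodule_one_eq_span_X,
    Submodule.mem_span_range_iff_exists_fun] at hp
  obtain ⟨c, rfl⟩ := hp
  exact ⟨c 0, c 1, by simp [Fin.sum_univ_two, smul_eq_C_mul]⟩

/-- Iterated partial derivatives of a power of a polynomial whose first partial derivative is
constant. -/
lemma MvPolynomial.iterate_pderiv_pow_of_pderiv_eq_C {R σ : Type*} [CommSemiring R] {i : σ}
    {p : MvPolynomial σ R} {a : R} (hp : pderiv i p = C a) (c : R) (n k : ℕ) :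
    (⇑(pderiv i))^[k] (c • p ^ n) = C (n.descFactorial k * a ^ k * c) * p ^ (n - k) := by
  induction k with
  | zero => simp [smul_eq_C_mul]
  | succ k ih =>
    rw [Function.iterate_succ_apply', ih, pderiv_C_mul, pderiv_pow, hp, Nat.descFactorial_succ,
      Nat.sub_sub]
    simp only [map_mul, map_pow, map_natCast, Nat.cast_mul]
    ring

/-- If `p₀ (a₀ y + b₀ z)ⁿ⁺¹ + p₁ (a₁ y + b₁ z)ⁿ⁺¹` vanishes to second order at `z = 0` and the
linear forms are independent, then `p₀ a₀ⁿ = 0`. -/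
lemma mul_pow_eq_zero_of_det_ne_zero {K : Type*} [Field K] {a₀ b₀ a₁ b₁ p₀ p₁ : K} {n : ℕ}
    (hdet : a₀ * b₁ - a₁ * b₀ ≠ 0)
    (h₀ : p₀ * a₀ ^ (n + 1) + p₁ * a₁ ^ (n + 1) = 0)
    (h₁ : p₀ * a₀ ^ n * b₀ + p₁ * a₁ ^ n * b₁ = 0) : p₀ * a₀ ^ n = 0 := by
  refine (mul_eq_zero.1 (?_ : p₀ * a₀ ^ n * (a₀ * b₁ - a₁ * b₀) = 0)).resolve_right hdet
  linear_combination b₁ * h₀ - a₁ * h₁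

/-- If `H ∈ K[y,z]` (with `y = X 0`, `z = X 1`) is a linear combination of at
most two `(2k+2)`-nd powers of pairwise linearly independent linear forms, and
`∂^k H/∂y^k` lies in `z³·K[y,z]_{k-1}`, then `∂^k H/∂y^k` is a scalar multiple
of `z^{k+2}`. -/
theorem deriv_H_scalar_multiple (K : Type*) [Field K] [IsAlgClosed K] [CharZero K]
    (k : ℕ) (hk : 1 ≤ k)
    (c : Fin 2 → K) (ℓ : Fin 2 → MvPolynomial (Fin 2) K)
    (hhom : ∀ i, (ℓ i).IsHomogeneous 1)
    (hind : LinearIndependent K ℓ)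
    (H : MvPolynomial (Fin 2) K)
    (hH : H = c 0 • ℓ 0 ^ (2 * k + 2) + c 1 • ℓ 1 ^ (2 * k + 2))
    (hdiv : ∃ G : MvPolynomial (Fin 2) K, G.IsHomogeneous (k - 1) ∧
      (⇑(pderiv (0 : Fin 2)))^[k] H = X 1 ^ 3 * G) :
    ∃ a : K, (⇑(pderiv (0 : Fin 2)))^[k] H = C a * X 1 ^ (k + 2) := by
  obtain ⟨G, -, hG⟩ := hdiv
  choose a b hab using fun i => (hhom i).exists_eq_binary_linear
  have hdy (i) : pderiv 0 (ℓ i) = C (a i) := by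
    rw [hab]; simp
  have hdz (i) : pderiv 1 (ℓ i) = C (b i) := by
    rw [hab]; simp
  have heval (i) : eval ![1, 0] (ℓ i) = a i := by
    rw [hab]; simp
  have hdet : a 0 * b 1 - a 1 * b 0 ≠ 0 := by
    intro h
    have hl := LinearIndependent.pair_iff.1
      (show LinearIndependent K ![ℓ 0, ℓ 1] by convert hind using 1; ext i; fin_cases i <;> rfl)
    have hC : (C (a 0) * C (b 1) - C (a 1) * C (b 0) : MvPolynomial (Fin 2) K) = 0 := by
      simp only [← map_mul, ← map_sub, h, map_zero]
    have ha := hl (a 1) (-a 0) (by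
      rw [hab 0, hab 1, smul_eq_C_mul, smul_eq_C_mul, map_neg]
      linear_combination (-X 1) * hC)
    have hb := hl (b 1) (-b 0) (by
      rw [hab 0, hab 1, smul_eq_C_mul, smul_eq_C_mul, map_neg]
      linear_combination X 0 * hC)
    refine hind.ne_zero 0 ?_
    rw [hab 0, neg_eq_zero.1 ha.2, neg_eq_zero.1 hb.2]
    simp
  have hD : (⇑(pderiv (0 : Fin 2)))^[k] H =
      C ((2 * k + 2).descFactorial k * a 0 ^ k * c 0) * ℓ 0 ^ (k + 2) +
      C ((2 * k + 2).descFactorial k * a 1 ^ k * c 1) * ℓ 1 ^ (k + 2) := by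
    rw [hH, iterate_map_add, iterate_pderiv_pow_of_pderiv_eq_C (hdy 0),
      iterate_pderiv_pow_of_pderiv_eq_C (hdy 1), show 2 * k + 2 - k = k + 2 by omega]
  set p : Fin 2 → K := fun i => (2 * k + 2).descFactorial k * a i ^ k * c i with hp
  have hpa (i) (h : p i * a i ^ (k + 1) = 0) : p i = 0 := by
    refine (mul_eq_zero.1 h).elim id fun h' => ?_
    simp [hp, eq_zero_of_pow_eq_zero h', Nat.one_le_iff_ne_zero.1 hk]
  change _ = C (p 0) * _ + C (p 1) * _ at hD
  rw [hD] at hG ⊢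
  have h₀ := congrArg (eval ![1, 0]) hG
  have h₁ := congrArg (fun q => eval ![1, 0] (pderiv 1 q)) hG
  simp [heval] at h₀
  simp [heval, hdz, Derivation.leibniz, Derivation.leibniz_pow] at h₁
  have h₁' : p 0 * a 0 ^ (k + 1) * b 0 + p 1 * a 1 ^ (k + 1) * b 1 = 0 := by
    refine (mul_eq_zero.1 (?_ : ((k : K) + 2) * _ = 0)).resolve_left
      (by exact_mod_cast (k + 1).succ_ne_zero)
    linear_combination h₁
  have hp₀ := hpa 0 (mul_pow_eq_zero_of_det_ne_zero hdet h₀ h₁')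
  have hp₁ := hpa 1 (mul_pow_eq_zero_of_det_ne_zero (a₁ := a 0) (b₀ := b 1) (b₁ := b 0) (p₁ := p 0)
    (fun h => hdet (by linear_combination -h)) (by linear_combination h₀)
    (by linear_combination h₁'))
  exact ⟨0, by simp [hp₀, hp₁]⟩
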